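/- Let ℓ ≥ 1 and k ≥ 1 be integers, θ ∈ ℂ^{2ℓ+1}, and let g and g̃ be Borel probability measures on [0,1] whose trigonometric moments agree up to order (k−1)ℓ, i.e. ∫₀¹ e^{−i2πrφ} dg(φ) = ∫₀¹ e^{−i2πrφ} dg̃(φ) for every integer r with |r| ≤ (k−1)ℓ. Then for every z ∈ ℂ^{2ℓ+1}, | p_{θ,g}(z) − p_{θ,g̃}(z) | ≤ 2 π^{−(2ℓ+1)} ( sup_{φ ∈ [0,1]} ‖z − θ•φ‖^{2k} ) / k!. -/

import Mathlib

open MeasureTheory Real Set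

/-- squared Euclidean (Hermitian) norm on ℂ^p -/
noncomputable def sqnorm (p : ℕ) (z : Fin p → ℂ) : ℝ := ∑ i, ‖z i‖ ^ 2

/-- density of the standard complex Gaussian on ℂ^p centered at μ,
with respect to Lebesgue measure on ℂ^p ≃ ℝ^{2p} -/
noncomputable def cgauss (p : ℕ) (μ z : Fin p → ℂ) : ℝ :=
  (Real.pi ^ p)⁻¹ * Real.exp (-sqnorm p (z - μ))

/-- the rotated vector θ•φ, coordinates indexed by k = i - ℓ ∈ {-ℓ,…,ℓ} -/
noncomputable def rot (ℓ : ℕ) (θ : Fin (2 * ℓ + 1) → ℂ) (φ : ℝ) : Fin (2 * ℓ + 1) → ℂ :=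
  fun i => θ i * Complex.exp (-Complex.I * (2 * Real.pi * (((i : ℤ) - (ℓ : ℤ) : ℤ) : ℝ) * φ))

/-- the H1 norm ‖θ‖_{H1} = (Σ_k k²|θ_k|²)^{1/2} -/
noncomputable def H1norm (ℓ : ℕ) (θ : Fin (2 * ℓ + 1) → ℂ) : ℝ :=
  Real.sqrt (∑ i : Fin (2 * ℓ + 1), ((((i : ℤ) - (ℓ : ℤ) : ℤ) : ℝ)) ^ 2 * ‖θ i‖ ^ 2)

/-- Hellinger distance between two (densities of) finite measures on ℂ^p -/
noncomputable def dHfin (p : ℕ) (q₁ q₂ : (Fin p → ℂ) → ℝ) : ℝ :=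
  Real.sqrt (∫ z, (Real.sqrt (q₁ z) - Real.sqrt (q₂ z)) ^ 2)

/-- g is a Borel probability measure on [0,1] (encoded as a measure on ℝ carried by [0,1]) -/
def IsProbOn01 (g : MeasureTheory.Measure ℝ) : Prop :=
  MeasureTheory.IsProbabilityMeasure g ∧ g (Set.Icc 0 1) = 1

/-- density z ↦ ∫₀¹ γ(z − θ•φ) dg(φ) of the Gaussian mixture P_{θ,g} on ℂ^{2ℓ+1} -/
noncomputable def mixDensity (ℓ : ℕ) (θ : Fin (2 * ℓ + 1) → ℂ) (g : Measure ℝ)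
    (z : Fin (2 * ℓ + 1) → ℂ) : ℝ :=
  ∫ φ, cgauss (2 * ℓ + 1) (rot ℓ θ φ) z ∂g

/-- the Gaussian mixture measure P_{θ,g} on ℂ^{2ℓ+1} -/
noncomputable def mixMeasure (ℓ : ℕ) (θ : Fin (2 * ℓ + 1) → ℂ) (g : Measure ℝ) :
    Measure (Fin (2 * ℓ + 1) → ℂ) :=
  volume.withDensity (fun z => ENNReal.ofReal (mixDensity ℓ θ g z))

/-- total variation distance between two measures: sup over measurable sets A
of |P(A) − Q(A)| -/
noncomputable def dTV {X : Type*} [MeasurableSpace X] (P Q : Measure X) : ℝ :=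
  ⨆ (A : Set X) (_ : MeasurableSet A), |(P A).toReal - (Q A).toReal|

/-- the character `φ ↦ e^{-i2πrφ}` -/
noncomputable def trigChar (r : ℤ) (φ : ℝ) : ℂ :=
  Complex.exp (-Complex.I * (2 * Real.pi * (r : ℝ) * φ))

lemma trigChar_zero : trigChar 0 = 1 := by
  ext φ
  simp [trigChar]

lemma trigChar_add (r s : ℤ) : trigChar (r + s) = trigChar r * trigChar s := by
  ext φ
  simp only [trigChar, Pi.mul_apply, ← Complex.exp_add]
  congr 1
  push_cast
  ring

lemma conj_trigChar (r : ℤ) (φ : ℝ) :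
    (starRingEnd ℂ) (trigChar r φ) = trigChar (-r) φ := by
  simp [trigChar, ← Complex.exp_conj, map_ofNat]

lemma norm_trigChar (r : ℤ) (φ : ℝ) : ‖trigChar r φ‖ = 1 := by
  simp [trigChar, Complex.norm_exp]

lemma continuous_trigChar (r : ℤ) : Continuous (trigChar r) := by
  unfold trigChar
  fun_prop

/-- trigonometric polynomials of degree at most `n` -/
noncomputable def trigPoly (n : ℕ) : Submodule ℂ (ℝ → ℂ) :=
  Submodule.span ℂ (trigChar '' {r : ℤ | |r| ≤ n})

lemma trigChar_mem_trigPoly {n : ℕ} {r : ℤ} (hr : |r| ≤ n) : trigChar r ∈ trigPoly n :=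
  Submodule.subset_span ⟨r, hr, rfl⟩

lemma trigPoly_mono {m n : ℕ} (h : m ≤ n) : trigPoly m ≤ trigPoly n := by
  refine Submodule.span_mono (image_mono fun r (hr : |r| ≤ m) => ?_)
  exact hr.trans (by exact_mod_cast h)

lemma mul_mem_trigPoly {m n : ℕ} {f h : ℝ → ℂ} (hf : f ∈ trigPoly m) (hh : h ∈ trigPoly n) :
    f * h ∈ trigPoly (m + n) := by
  have hle : trigPoly m * trigPoly n ≤ trigPoly (m + n) := by
    unfold trigPoly
    rw [Submodule.span_mul_span]
    refine Submodule.span_mono ?_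
    rintro _ ⟨_, ⟨r, hr, rfl⟩, _, ⟨s, hs, rfl⟩, rfl⟩
    refine ⟨r + s, ?_, trigChar_add r s⟩
    simp only [mem_ofPred_eq] at hr hs ⊢
    push_cast
    exact (abs_add_le r s).trans (add_le_add hr hs)
  exact hle (Submodule.mul_mem_mul hf hh)

lemma one_mem_trigPoly (n : ℕ) : (1 : ℝ → ℂ) ∈ trigPoly n := by
  rw [← trigChar_zero]
  exact trigChar_mem_trigPoly (by simp)

lemma pow_mem_trigPoly {n : ℕ} {f : ℝ → ℂ} (hf : f ∈ trigPoly n) (j : ℕ) :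
    f ^ j ∈ trigPoly (j * n) := by
  induction j with
  | zero => simpa using one_mem_trigPoly 0
  | succ j ih =>
    rw [pow_succ, add_mul, one_mul]
    exact mul_mem_trigPoly ih hf

lemma integrable_of_mem_trigPoly {n : ℕ} {f : ℝ → ℂ} (hf : f ∈ trigPoly n)
    (g : Measure ℝ) [IsFiniteMeasure g] : Integrable f g := by
  induction hf using Submodule.span_induction with
  | mem f hf =>
    obtain ⟨r, -, rfl⟩ := hf
    exact Integrable.of_bound (continuous_trigChar r).aestronglyMeasurable 1
      (.of_forall fun φ => (norm_trigChar r φ).le)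
  | zero => exact integrable_zero _ _ _
  | add f h _ _ ihf ihh => exact ihf.add ihh
  | smul c f _ ih => exact ih.smul c

lemma integral_eq_of_mem_trigPoly {n : ℕ} {g gt : Measure ℝ} [IsFiniteMeasure g]
    [IsFiniteMeasure gt]
    (hmom : ∀ r : ℤ, |r| ≤ n → ∫ φ, trigChar r φ ∂g = ∫ φ, trigChar r φ ∂gt)
    {f : ℝ → ℂ} (hf : f ∈ trigPoly n) : ∫ φ, f φ ∂g = ∫ φ, f φ ∂gt := by
  induction hf using Submodule.span_induction with
  | mem f hf =>
    obtain ⟨r, hr, rfl⟩ := hf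
    exact hmom r hr
  | zero => simp
  | add f h hf hh ihf ihh =>
    simp only [Pi.add_apply]
    rw [integral_add (integrable_of_mem_trigPoly hf g) (integrable_of_mem_trigPoly hh g),
      integral_add (integrable_of_mem_trigPoly hf gt) (integrable_of_mem_trigPoly hh gt), ihf, ihh]
  | smul c f _ ih =>
    simp only [Pi.smul_apply]
    rw [integral_smul, integral_smul, ih]

lemma rot_apply (ℓ : ℕ) (θ : Fin (2 * ℓ + 1) → ℂ) (φ : ℝ) (i : Fin (2 * ℓ + 1)) :
    rot ℓ θ φ i = θ i * trigChar ((i : ℤ) - ℓ) φ := rfl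

lemma sqnorm_nonneg (p : ℕ) (z : Fin p → ℂ) : 0 ≤ sqnorm p z :=
  Finset.sum_nonneg fun _ _ => sq_nonneg _

lemma continuous_sqnorm_sub_rot (ℓ : ℕ) (θ z : Fin (2 * ℓ + 1) → ℂ) :
    Continuous fun φ => sqnorm (2 * ℓ + 1) (z - rot ℓ θ φ) := by
  simp only [sqnorm, Pi.sub_apply, rot_apply]
  have := continuous_trigChar
  fun_prop

lemma sqnorm_sub_rot_mem_trigPoly (ℓ : ℕ) (θ z : Fin (2 * ℓ + 1) → ℂ) :
    (fun φ => (sqnorm (2 * ℓ + 1) (z - rot ℓ θ φ) : ℂ)) ∈ trigPoly ℓ := by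
  have heq : (fun φ => (sqnorm (2 * ℓ + 1) (z - rot ℓ θ φ) : ℂ)) =
      ∑ i : Fin (2 * ℓ + 1),
        ((z i * (starRingEnd ℂ) (z i) + θ i * (starRingEnd ℂ) (θ i)) • (1 : ℝ → ℂ)
          - (z i * (starRingEnd ℂ) (θ i)) • trigChar (-((i : ℤ) - ℓ))
          - (θ i * (starRingEnd ℂ) (z i)) • trigChar ((i : ℤ) - ℓ)) := by
    ext φ
    simp only [sqnorm, Complex.ofReal_sum, Finset.sum_apply]
    refine Finset.sum_congr rfl fun i _ => ?_
    have hone : trigChar ((i : ℤ) - ℓ) φ * trigChar (-((i : ℤ) - ℓ)) φ = 1 := by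
      rw [← Pi.mul_apply, ← trigChar_add, add_neg_cancel, trigChar_zero, Pi.one_apply]
    rw [Complex.ofReal_pow, ← Complex.mul_conj']
    simp only [Pi.sub_apply, Pi.smul_apply, rot_apply, map_sub, map_mul, conj_trigChar,
      smul_eq_mul, Pi.one_apply]
    linear_combination θ i * (starRingEnd ℂ) (θ i) * hone
  rw [heq]
  refine Submodule.sum_mem _ fun i _ => ?_
  have hi : |(i : ℤ) - ℓ| ≤ ℓ := by
    have := i.isLt
    rw [abs_le]
    omega
  exact sub_mem (sub_mem (Submodule.smul_mem _ _ (one_mem_trigPoly ℓ))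
    (Submodule.smul_mem _ _ (trigChar_mem_trigPoly (by rwa [abs_neg]))))
    (Submodule.smul_mem _ _ (trigChar_mem_trigPoly hi))

/-- the Taylor polynomial of `y ↦ e^{-y}` with `k` terms -/
noncomputable def expNegTaylor (k : ℕ) (y : ℝ) : ℝ :=
  ∑ j ∈ Finset.range k, (-1) ^ j / (j.factorial : ℝ) * y ^ j

lemma hasDerivAt_expNegTaylor_succ (k : ℕ) (y : ℝ) :
    HasDerivAt (expNegTaylor (k + 1)) (-expNegTaylor k y) y := by
  have h : HasDerivAt (expNegTaylor (k + 1))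
      (∑ j ∈ Finset.range (k + 1),
        (-1) ^ j / (j.factorial : ℝ) * ((j : ℝ) * y ^ (j - 1))) y :=
    HasDerivAt.fun_sum fun j _ => (hasDerivAt_pow j y).const_mul _
  convert h using 1
  rw [Finset.sum_range_succ', expNegTaylor, ← Finset.sum_neg_distrib]
  simp only [Nat.cast_zero, zero_mul, mul_zero, add_zero, add_tsub_cancel_right]
  refine Finset.sum_congr rfl fun j _ => ?_
  rw [Nat.factorial_succ]
  have : (j.factorial : ℝ) ≠ 0 := by positivity
  push_cast
  field_simp
  ring

lemma abs_exp_neg_sub_expNegTaylor_le (k : ℕ) {y : ℝ} (hy : 0 ≤ y) :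
    |Real.exp (-y) - expNegTaylor k y| ≤ y ^ k / k.factorial := by
  induction k generalizing y with
  | zero => simpa [expNegTaylor] using hy
  | succ k ih =>
    have hf (x : ℝ) : HasDerivAt (fun x => Real.exp (-x) - expNegTaylor (k + 1) x)
        (-(Real.exp (-x) - expNegTaylor k x)) x := by
      refine ((hasDerivAt_neg x).exp.sub (hasDerivAt_expNegTaylor_succ k x)).congr_deriv ?_
      ring
    have hB (x : ℝ) : HasDerivAt (fun x : ℝ => x ^ (k + 1) / (k + 1).factorial)
        (x ^ k / k.factorial) x := by
      refine ((hasDerivAt_pow (k + 1) x).div_const ((k + 1).factorial : ℝ)).congr_deriv ?_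
      rw [Nat.factorial_succ]
      have : (k.factorial : ℝ) ≠ 0 := by positivity
      push_cast
      field_simp
    refine image_norm_le_of_norm_deriv_right_le_deriv_boundary (a := 0) (b := y)
      (fun x _ => (hf x).continuousAt.continuousWithinAt)
      (fun x _ => (hf x).hasDerivWithinAt) ?_ hB ?_ (right_mem_Icc.2 hy)
    · simp [expNegTaylor, Finset.sum_range_succ']
    · intro x hx
      rw [norm_neg]
      exact ih hx.1

lemma le_biSup_of_continuous {f : ℝ → ℝ} (hf : Continuous f) (h0 : ∀ x, 0 ≤ f x) {s : Set ℝ}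
    (hs : IsCompact s) {x : ℝ} (hx : x ∈ s) : f x ≤ ⨆ y ∈ s, f y := by
  obtain ⟨C, hC⟩ := hs.bddAbove_image hf.continuousOn
  have hC' : ∀ y ∈ s, f y ≤ C := fun y hy => hC (mem_image_of_mem f hy)
  have hbdd : BddAbove (range fun y => ⨆ _ : y ∈ s, f y) := by
    refine ⟨C, ?_⟩
    rintro _ ⟨y, rfl⟩
    exact Real.iSup_le (hC' y) ((h0 x).trans (hC' x hx))
  refine le_ciSup_of_le hbdd x ?_
  simp [hx]

lemma integrable_sqnorm_sub_rot_pow (ℓ : ℕ) (θ z : Fin (2 * ℓ + 1) → ℂ) (j : ℕ)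
    (g : Measure ℝ) [IsFiniteMeasure g] :
    Integrable (fun φ => sqnorm (2 * ℓ + 1) (z - rot ℓ θ φ) ^ j) g := by
  have h := (integrable_of_mem_trigPoly
    (pow_mem_trigPoly (sqnorm_sub_rot_mem_trigPoly ℓ θ z) j) g).re
  convert h using 2 with φ
  simp [← Complex.ofReal_pow]

lemma integrable_expNegTaylor_sqnorm_sub_rot (ℓ : ℕ) (θ z : Fin (2 * ℓ + 1) → ℂ) (k : ℕ)
    (g : Measure ℝ) [IsFiniteMeasure g] :
    Integrable (fun φ => expNegTaylor k (sqnorm (2 * ℓ + 1) (z - rot ℓ θ φ))) g :=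
  integrable_finsetSum _ fun j _ => (integrable_sqnorm_sub_rot_pow ℓ θ z j g).const_mul _

lemma integral_expNegTaylor_sqnorm_sub_rot_eq {ℓ k : ℕ} (θ z : Fin (2 * ℓ + 1) → ℂ)
    {g gt : Measure ℝ} [IsFiniteMeasure g] [IsFiniteMeasure gt]
    (hmom : ∀ r : ℤ, |r| ≤ ((k - 1) * ℓ : ℕ) →
      ∫ φ, trigChar r φ ∂g = ∫ φ, trigChar r φ ∂gt) :
    ∫ φ, expNegTaylor k (sqnorm (2 * ℓ + 1) (z - rot ℓ θ φ)) ∂g =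
      ∫ φ, expNegTaylor k (sqnorm (2 * ℓ + 1) (z - rot ℓ θ φ)) ∂gt := by
  simp only [expNegTaylor]
  rw [integral_finsetSum _ fun j _ => (integrable_sqnorm_sub_rot_pow ℓ θ z j g).const_mul _,
    integral_finsetSum _ fun j _ => (integrable_sqnorm_sub_rot_pow ℓ θ z j gt).const_mul _]
  refine Finset.sum_congr rfl fun j hj => ?_
  rw [integral_const_mul, integral_const_mul]
  congr 1
  have hjk : j * ℓ ≤ (k - 1) * ℓ :=
    Nat.mul_le_mul_right _ (Nat.le_sub_one_of_lt (Finset.mem_range.1 hj))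
  have h := integral_eq_of_mem_trigPoly hmom (trigPoly_mono hjk
    (pow_mem_trigPoly (sqnorm_sub_rot_mem_trigPoly ℓ θ z) j))
  simp only [Pi.pow_apply, ← Complex.ofReal_pow, integral_complex_ofReal] at h
  exact_mod_cast h

lemma integrable_exp_neg_sqnorm_sub_rot (ℓ : ℕ) (θ z : Fin (2 * ℓ + 1) → ℂ)
    (g : Measure ℝ) [IsFiniteMeasure g] :
    Integrable (fun φ => Real.exp (-sqnorm (2 * ℓ + 1) (z - rot ℓ θ φ))) g := by
  refine Integrable.of_bound
    (continuous_sqnorm_sub_rot ℓ θ z).neg.rexp.aestronglyMeasurable 1 (.of_forall fun φ => ?_)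
  simpa using sqnorm_nonneg _ _

lemma abs_integral_exp_neg_sub_expNegTaylor_le (ℓ k : ℕ) (θ z : Fin (2 * ℓ + 1) → ℂ)
    {g : Measure ℝ} (hg : IsProbOn01 g) :
    |∫ φ, Real.exp (-sqnorm (2 * ℓ + 1) (z - rot ℓ θ φ)) ∂g
        - ∫ φ, expNegTaylor k (sqnorm (2 * ℓ + 1) (z - rot ℓ θ φ)) ∂g|
      ≤ (⨆ φ ∈ Set.Icc (0 : ℝ) 1, sqnorm (2 * ℓ + 1) (z - rot ℓ θ φ) ^ k) / k.factorial := by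
  obtain ⟨hprob, hone⟩ := hg
  rw [← integral_sub (integrable_exp_neg_sqnorm_sub_rot ℓ θ z g)
    (integrable_expNegTaylor_sqnorm_sub_rot ℓ θ z k g)]
  have hae : ∀ᵐ φ ∂g, φ ∈ Set.Icc (0 : ℝ) 1 :=
    (mem_ae_iff_prob_eq_one measurableSet_Icc).2 hone
  rw [← Real.norm_eq_abs]
  refine (norm_integral_le_of_norm_le_const (hae.mono fun φ hφ => ?_)).trans_eq
    (by rw [probReal_univ, mul_one])
  refine (abs_exp_neg_sub_expNegTaylor_le k (sqnorm_nonneg _ _)).trans ?_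
  gcongr
  exact le_biSup_of_continuous ((continuous_sqnorm_sub_rot ℓ θ z).pow k)
    (fun φ => pow_nonneg (sqnorm_nonneg _ _) k) isCompact_Icc hφ

/-- if the trigonometric moments of g and g̃ agree up to order (k−1)ℓ, then
|p_{θ,g}(z) − p_{θ,g̃}(z)| ≤ 2 π^{−(2ℓ+1)} (sup_{φ∈[0,1]} ‖z − θ•φ‖^{2k}) / k!. -/
theorem mixture_density_diff_of_matching_moments
    (ℓ k : ℕ) (hℓ : 1 ≤ ℓ) (hk : 1 ≤ k) (θ : Fin (2 * ℓ + 1) → ℂ)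
    (g gt : Measure ℝ) (hg : IsProbOn01 g) (hgt : IsProbOn01 gt)
    (hmom : ∀ r : ℤ, |r| ≤ (k - 1 : ℕ) * ℓ →
      (∫ φ, Complex.exp (-Complex.I * (2 * Real.pi * (r : ℝ) * φ)) ∂g)
        = ∫ φ, Complex.exp (-Complex.I * (2 * Real.pi * (r : ℝ) * φ)) ∂gt) :
    ∀ z : Fin (2 * ℓ + 1) → ℂ,
      |mixDensity ℓ θ g z - mixDensity ℓ θ gt z|
        ≤ 2 * (Real.pi ^ (2 * ℓ + 1))⁻¹
          * (⨆ φ ∈ Set.Icc (0 : ℝ) 1, sqnorm (2 * ℓ + 1) (z - rot ℓ θ φ) ^ k)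
          / (Nat.factorial k) := by
  intro z
  have := hg.1
  have := hgt.1
  have hmom' : ∀ r : ℤ, |r| ≤ ((k - 1) * ℓ : ℕ) →
      ∫ φ, trigChar r φ ∂g = ∫ φ, trigChar r φ ∂gt :=
    fun r hr => hmom r (by rwa [Nat.cast_mul] at hr)
  have heq := integral_expNegTaylor_sqnorm_sub_rot_eq θ z hmom'
  have h₁ := abs_integral_exp_neg_sub_expNegTaylor_le ℓ k θ z hg
  have h₂ := abs_integral_exp_neg_sub_expNegTaylor_le ℓ k θ z hgt
  rw [heq] at h₁
  rw [abs_sub_comm] at h₂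
  simp only [mixDensity, cgauss]
  rw [integral_const_mul, integral_const_mul, ← mul_sub, abs_mul,
    abs_of_nonneg (by positivity : (0 : ℝ) ≤ (Real.pi ^ (2 * ℓ + 1))⁻¹)]
  calc _ ≤ (Real.pi ^ (2 * ℓ + 1))⁻¹ * _ :=
        mul_le_mul_of_nonneg_left ((abs_sub_le _ _ _).trans (add_le_add h₁ h₂)) (by positivity)
    _ = _ := by ring
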